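/- arXiv:2211.01945 — 6 statements merged into one kernel-verified Lean document; each statement's English description precedes it below -/
import Mathlib

section
/- For any two subsets C, C' of 𝔠, the label ℓ(C') is at least as strong as the label ℓ(C) according to the hyperedge constraint ℰ_Π (i.e., ℓ(C) ≤ ℓ(C')) if and only if C' ⊆ C. -/
open scoped Classical

/-- `StrEq 𝒞 B A` : the label `A` is at least as strong as the label `B` according to the
constraint `𝒞` (written `B ≤ A`): every configuration of `𝒞` containing `B` remains a
configuration of `𝒞` after replacing one occurrence of `B` by `A`. -/
def StrEq {L : Type*} [DecidableEq L] (𝒞 : Set (Multiset L)) (B A : L) : Prop :=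
  ∀ m ∈ 𝒞, B ∈ m → (A ::ₘ m.erase B) ∈ 𝒞

/-- The hyperedge constraint ℰ_Π: the label `ℓ(C)` is identified with the color set
`C ⊆ 𝔠 = {1, …, Δ}` (here `Finset (Fin Δ)`), and a hyperedge configuration is a multiset of
`r` labels `ℓ(C₁) … ℓ(C_r)` such that for each color `i` there is at least one index `j`
with `i ∉ C_j`. -/
def EPi (Δ r : ℕ) : Set (Multiset (Finset (Fin Δ))) :=
  {m | Multiset.card m = r ∧ ∀ i : Fin Δ, ∃ C ∈ m, i ∉ C}

/-- For any two subsets `C, C'` of `𝔠`, the label `ℓ(C')` is at least as strong as `ℓ(C)`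
according to the hyperedge constraint ℰ_Π if and only if `C' ⊆ C`. -/
theorem stmt_0 (Δ r : ℕ) (hΔ : 2 ≤ Δ) (hr : 2 ≤ r) (C C' : Finset (Fin Δ)) :
    StrEq (EPi Δ r) C C' ↔ C' ⊆ C := by
  constructor
  · intro h i hi
    by_contra hiC
    have hm : (C ::ₘ Multiset.replicate (r - 1) Cᶜ) ∈ EPi Δ r := by
      refine ⟨by simp; omega, fun j => ?_⟩
      by_cases hj : j ∈ C
      · exact ⟨Cᶜ, Multiset.mem_cons_of_mem
          (Multiset.mem_replicate.2 ⟨by omega, rfl⟩), by simpa using hj⟩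
      · exact ⟨C, Multiset.mem_cons_self _ _, hj⟩
    have h2 := h _ hm (Multiset.mem_cons_self _ _)
    rw [Multiset.erase_cons_head] at h2
    obtain ⟨D, hD, hiD⟩ := h2.2 i
    rcases Multiset.mem_cons.1 hD with rfl | hD
    · exact hiD hi
    · rw [Multiset.eq_of_mem_replicate hD] at hiD
      exact hiD (Finset.mem_compl.2 hiC)
  · intro hsub m hm hC
    refine ⟨?_, fun i => ?_⟩
    · rw [Multiset.card_cons, Multiset.card_erase_add_one hC]
      exact hm.1
    · obtain ⟨D, hD, hiD⟩ := hm.2 i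
      by_cases hDC : D = C
      · subst hDC
        exact ⟨C', Multiset.mem_cons_self _ _, fun h => hiD (hsub h)⟩
      · exact ⟨D, Multiset.mem_cons_of_mem ((Multiset.mem_erase_of_ne hDC).2 hD), hiD⟩
end

section
/- For each subset C ⊆ 𝔠, the set ⟨ℓ(C)⟩ of all labels that are at least as strong as ℓ(C) according to the hyperedge constraint ℰ_Π equals {ℓ(C') : C' ⊆ C}. -/
open scoped Classical

/-- For each subset `C ⊆ 𝔠`, the set `⟨ℓ(C)⟩` of all labels that are at least as strong as
`ℓ(C)` according to the hyperedge constraint ℰ_Π equals `{ℓ(C') : C' ⊆ C}`. -/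
theorem stmt_1 (Δ r : ℕ) (hΔ : 2 ≤ Δ) (hr : 2 ≤ r) (C : Finset (Fin Δ)) :
    {A : Finset (Fin Δ) | StrEq (EPi Δ r) C A} = {C' : Finset (Fin Δ) | C' ⊆ C} := by
  ext A
  simp only [Set.mem_setOf_eq]
  constructor
  · intro h a ha
    by_contra hc
    have hm : (C ::ₘ Multiset.replicate (r - 1) (Cᶜ)) ∈ EPi Δ r := by
      refine ⟨by simp; omega, fun i => ?_⟩
      by_cases hi : i ∈ C
      · refine ⟨Cᶜ, Multiset.mem_cons_of_mem ?_, by simpa using hi⟩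
        exact Multiset.mem_replicate.2 ⟨by omega, rfl⟩
      · exact ⟨C, Multiset.mem_cons_self _ _, hi⟩
    have h2 := h _ hm (Multiset.mem_cons_self _ _)
    rw [Multiset.erase_cons_head] at h2
    obtain ⟨D, hD, haD⟩ := h2.2 a
    rcases Multiset.mem_cons.1 hD with rfl | hD
    · exact haD ha
    · rw [Multiset.eq_of_mem_replicate hD] at haD
      exact haD (Finset.mem_compl.2 hc)
  · intro h m hm hC
    refine ⟨?_, fun i => ?_⟩
    · rw [← hm.1, ← Multiset.cons_erase hC]
      simp
    · obtain ⟨D, hD, hi⟩ := hm.2 i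
      by_cases hDC : D = C
      · subst hDC
        exact ⟨A, Multiset.mem_cons_self _ _, fun hh => hi (h hh)⟩
      · exact ⟨D, Multiset.mem_cons_of_mem ((Multiset.mem_erase_of_ne hDC).2 hD), hi⟩
end

section
/- The label set Σ_ℛ of ℛ(Π) equals {⟨ℓ(C)⟩ : C ⊆ 𝔠}, where ⟨·⟩ is taken according to ℰ_Π, and the hyperedge constraint ℰ_ℛ of ℛ(Π) consists exactly of the configurations ⟨ℓ(C_1)⟩ … ⟨ℓ(C_r)⟩ of such labels for which, for each color i ∈ 𝔠, there is exactly one index 1 ≤ j ≤ r with i ∉ C_j. -/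
open scoped Classical

/-- `IsChoice m c` : the multiset `c` is obtained by choosing one element from each of the
sets in the configuration `m`. -/
def IsChoice {L : Type*} (m : Multiset (Set L)) (c : Multiset L) : Prop :=
  Multiset.Rel (fun B a => a ∈ B) m c

/-- The node constraint 𝒩_Π: the configurations `ℓ(C)^{Δ−|C|+1} ℓ(∅)^{|C|−1}` for
nonempty `C ⊆ 𝔠`. -/
def NPi (Δ : ℕ) : Set (Multiset (Finset (Fin Δ))) :=
  {m | ∃ C : Finset (Fin Δ), C ≠ ∅ ∧
    m = Multiset.replicate (Δ - C.card + 1) C +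
        Multiset.replicate (C.card - 1) (∅ : Finset (Fin Δ))}

/-- `⟨ℓ(C)⟩`, the set of all labels at least as strong as `ℓ(C)` according to ℰ_Π. -/
def genE (Δ r : ℕ) (C : Finset (Fin Δ)) : Set (Finset (Fin Δ)) :=
  {A | StrEq (EPi Δ r) C A}

/-- Configurations `B₁ … B_r` of nonempty subsets of Σ_Π all of whose choices form
configurations of ℰ_Π. -/
def ECand (Δ r : ℕ) : Set (Multiset (Set (Finset (Fin Δ)))) :=
  {m | Multiset.card m = r ∧ (∀ B ∈ m, B.Nonempty) ∧ ∀ c, IsChoice m c → c ∈ EPi Δ r}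

/-- The hyperedge constraint ℰ_ℛ of ℛ(Π): the maximal configurations among `ECand`. -/
def ER (Δ r : ℕ) : Set (Multiset (Set (Finset (Fin Δ)))) :=
  {m | m ∈ ECand Δ r ∧ ∀ m' ∈ ECand Δ r, Multiset.Rel (· ⊆ ·) m m' → m = m'}

/-- The label set Σ_ℛ of ℛ(Π): the subsets of Σ_Π occurring in configurations of ℰ_ℛ. -/
def SigR (Δ r : ℕ) : Set (Set (Finset (Fin Δ))) :=
  {B | ∃ m ∈ ER Δ r, B ∈ m}

/-- The node constraint 𝒩_ℛ of ℛ(Π): configurations `B₁ … B_Δ` of labels of Σ_ℛ such that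
some choice forms a configuration of 𝒩_Π. -/
def NR (Δ r : ℕ) : Set (Multiset (Set (Finset (Fin Δ)))) :=
  {m | Multiset.card m = Δ ∧ (∀ B ∈ m, B ∈ SigR Δ r) ∧ ∃ c, IsChoice m c ∧ c ∈ NPi Δ}

theorem rel_eq_of_sum {α : Type*} (R : α → α → Prop) (g : α → ℕ)
    (h1 : ∀ a b, R a b → g b ≤ g a) (h2 : ∀ a b, R a b → g a = g b → a = b)
    {s t : Multiset α} (h : Multiset.Rel R s t) :
    (t.map g).sum ≤ (s.map g).sum ∧ ((s.map g).sum = (t.map g).sum → s = t) := by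
  induction h with
  | zero => simp
  | @cons a b as bs hab _ ih =>
    have := h1 a b hab
    refine ⟨by simp; omega, fun he => ?_⟩
    simp at he
    rw [h2 a b hab (by omega), ih.2 (by omega)]

theorem sum_compl (Δ : ℕ) (Cs : Multiset (Finset (Fin Δ))) :
    (Cs.map (fun C => Cᶜ.card)).sum = ∑ i, Multiset.countP (fun C => i ∉ C) Cs := by
  induction Cs using Multiset.induction_on with
  | empty => simp
  | cons a s ih =>
    simp only [Multiset.map_cons, Multiset.sum_cons, ih, Multiset.countP_cons,
      Finset.sum_add_distrib]
    rw [add_comm]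
    congr 1
    rw [← Finset.card_filter]
    congr 1
    ext i
    simp

theorem mem_genE (Δ r : ℕ) (hr : 2 ≤ r) (C A : Finset (Fin Δ)) : A ∈ genE Δ r C ↔ A ⊆ C := by
  constructor
  · intro h i hi
    by_contra hC
    have h' := h (C ::ₘ Multiset.replicate (r - 1) Cᶜ) ?_ (by simp)
    · obtain ⟨D, hD, hiD⟩ := h'.2 i
      simp only [Multiset.erase_cons_head, Multiset.mem_cons] at hD
      rcases hD with rfl | hD
      · exact hiD hi
      · rw [Multiset.eq_of_mem_replicate hD] at hiD
        simp [hC] at hiD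
    · refine ⟨by simp; omega, fun k => ?_⟩
      by_cases hk : k ∈ C
      · refine ⟨Cᶜ, ?_, by simpa using hk⟩
        rw [Multiset.mem_cons, Multiset.mem_replicate]
        exact Or.inr ⟨by omega, rfl⟩
      · exact ⟨C, by simp, hk⟩
  · intro h m hm hC
    refine ⟨?_, fun i => ?_⟩
    · rw [Multiset.card_cons, Multiset.card_erase_add_one hC]
      exact hm.1
    · obtain ⟨D, hD, hi⟩ := hm.2 i
      by_cases hDC : D = C
      · subst hDC
        exact ⟨A, by simp, fun hh => hi (h hh)⟩
      · exact ⟨D, Multiset.mem_cons_of_mem ((Multiset.mem_erase_of_ne hDC).2 hD), hi⟩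

theorem map_mem_ECand (Δ r : ℕ) (hr : 2 ≤ r) (Cs : Multiset (Finset (Fin Δ)))
    (hc : Multiset.card Cs = r) (h : ∀ i : Fin Δ, Multiset.countP (fun C => i ∉ C) Cs = 1) :
    Cs.map (genE Δ r) ∈ ECand Δ r := by
  refine ⟨by simpa using hc, ?_, ?_⟩
  · intro B hB
    obtain ⟨C, -, rfl⟩ := Multiset.mem_map.1 hB
    exact ⟨C, (mem_genE Δ r hr C C).2 subset_rfl⟩
  · intro c hcc
    refine ⟨by rw [← Multiset.card_eq_card_of_rel hcc]; simpa using hc, fun i => ?_⟩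
    have hpos : 0 < Multiset.countP (fun C => i ∉ C) Cs := by rw [h i]; exact one_pos
    obtain ⟨C, hC, hi⟩ := Multiset.countP_pos.1 hpos
    obtain ⟨a, ha, haC⟩ := Multiset.exists_mem_of_rel_of_mem hcc
      (Multiset.mem_map_of_mem (genE Δ r) hC)
    exact ⟨a, ha, fun hh => hi ((mem_genE Δ r hr C a).1 haC hh)⟩

theorem exists_dom (Δ r : ℕ) (hr : 2 ≤ r) (m : Multiset (Set (Finset (Fin Δ))))
    (hm : m ∈ ECand Δ r) : ∃ Cs : Multiset (Finset (Fin Δ)), Multiset.card Cs = r ∧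
      (∀ i : Fin Δ, Multiset.countP (fun C => i ∉ C) Cs = 1) ∧
      Multiset.Rel (· ⊆ ·) m (Cs.map (genE Δ r)) := by
  obtain ⟨hcard, hne, hch⟩ := hm
  obtain ⟨f, rfl⟩ : ∃ f : Fin r → Set (Finset (Fin Δ)), m = Finset.univ.val.map f := by
    induction m using Quotient.inductionOn with
    | _ l =>
      have hl : l.length = r := by simpa using hcard
      subst hl
      refine ⟨l.get, ?_⟩
      rw [Fin.univ_val_map, List.ofFn_get]
      rfl
  have key : ∀ i : Fin Δ, ∃ j, ∀ A ∈ f j, i ∉ A := by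
    intro i
    by_contra! hcon
    choose g hg hgi using hcon
    have := hch (Finset.univ.val.map g) (by
      unfold IsChoice
      rw [Multiset.rel_map]
      exact Multiset.rel_refl_of_refl_on fun j _ => hg j)
    obtain ⟨C, hC, hi⟩ := this.2 i
    obtain ⟨j, -, rfl⟩ := Multiset.mem_map.1 hC
    exact hi (hgi j)
  choose J hJ using key
  refine ⟨Finset.univ.val.map (fun j => Finset.univ.filter fun i => J i ≠ j), by simp, ?_, ?_⟩
  · intro i
    rw [Multiset.countP_map]
    simp only [Finset.mem_filter, Finset.mem_univ, true_and, not_not]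
    rw [← Finset.filter_val, Finset.card_val, Finset.card_eq_one]
    exact ⟨J i, by ext; simp [eq_comm]⟩
  · rw [Multiset.map_map, Multiset.rel_map]
    refine Multiset.rel_refl_of_refl_on fun j _ A hA => ?_
    refine (mem_genE Δ r hr _ A).2 fun i hi => ?_
    simp only [Finset.mem_filter, Finset.mem_univ, true_and]
    rintro rfl
    exact hJ i A hA hi

theorem ER_eq (Δ r : ℕ) (hr : 2 ≤ r) :
    ER Δ r = {m | ∃ Cs : Multiset (Finset (Fin Δ)), Multiset.card Cs = r ∧
        m = Cs.map (genE Δ r) ∧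
        ∀ i : Fin Δ, Multiset.countP (fun C => i ∉ C) Cs = 1} := by
  ext m
  constructor
  · rintro ⟨hm, hmax⟩
    obtain ⟨Cs, h1, h2, h3⟩ := exists_dom Δ r hr m hm
    exact ⟨Cs, h1, hmax _ (map_mem_ECand Δ r hr Cs h1 h2) h3, h2⟩
  · rintro ⟨Cs, h1, rfl, h2⟩
    refine ⟨map_mem_ECand Δ r hr Cs h1 h2, fun m' hm' hrel => ?_⟩
    obtain ⟨Ds, d1, d2, d3⟩ := exists_dom Δ r hr m' hm'
    have hg1 : ∀ a b : Set (Finset (Fin Δ)), a ⊆ b → bᶜ.ncard ≤ aᶜ.ncard := fun a b hab =>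
      Set.ncard_le_ncard (Set.compl_subset_compl.2 hab) (Set.toFinite _)
    have hg2 : ∀ a b : Set (Finset (Fin Δ)), a ⊆ b → aᶜ.ncard = bᶜ.ncard → a = b :=
      fun a b hab he => (compl_injective (Set.eq_of_subset_of_ncard_le
        (Set.compl_subset_compl.2 hab) he.le (Set.toFinite _))).symm
    have r12 := rel_eq_of_sum (· ⊆ ·) (fun a : Set (Finset (Fin Δ)) => aᶜ.ncard) hg1 hg2 hrel
    have r23 := rel_eq_of_sum (· ⊆ ·) (fun a : Set (Finset (Fin Δ)) => aᶜ.ncard) hg1 hg2 d3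
    have hrel2 : Multiset.Rel (· ⊆ ·) (Cs.map (genE Δ r)) (Ds.map (genE Δ r)) :=
      Multiset.Rel.trans _ hrel d3
    rw [Multiset.rel_map] at hrel2
    have hrel3 : Multiset.Rel (· ⊆ ·) Cs Ds := hrel2.mono fun a _ b _ hab =>
      (mem_genE Δ r hr b a).1 (hab ((mem_genE Δ r hr a a).2 subset_rfl))
    have hCD : Cs = Ds := by
      refine (rel_eq_of_sum (· ⊆ ·) (fun C : Finset (Fin Δ) => Cᶜ.card) ?_ ?_ hrel3).2 ?_
      · intro a b hab
        exact Finset.card_le_card (Finset.compl_subset_compl.2 hab)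
      · intro a b hab he
        exact (compl_injective (Finset.eq_of_subset_of_card_le
          (Finset.compl_subset_compl.2 hab) he.le)).symm
      · rw [sum_compl, sum_compl]
        simp only [h2, d2]
    subst hCD
    exact r12.2 (le_antisymm r23.1 r12.1)

/-- The label set Σ_ℛ of ℛ(Π) equals `{⟨ℓ(C)⟩ : C ⊆ 𝔠}`, and the hyperedge constraint ℰ_ℛ
consists exactly of the configurations `⟨ℓ(C₁)⟩ … ⟨ℓ(C_r)⟩` of such labels for which, for
each color `i ∈ 𝔠`, there is exactly one index `j` with `i ∉ C_j`. -/
theorem stmt_2 (Δ r : ℕ) (hΔ : 2 ≤ Δ) (hr : 2 ≤ r) :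
    SigR Δ r = {B | ∃ C : Finset (Fin Δ), B = genE Δ r C} ∧
    ER Δ r = {m | ∃ Cs : Multiset (Finset (Fin Δ)), Multiset.card Cs = r ∧
        m = Cs.map (genE Δ r) ∧
        ∀ i : Fin Δ, Multiset.countP (fun C => i ∉ C) Cs = 1} := by
  refine ⟨?_, ER_eq Δ r hr⟩
  ext B
  constructor
  · rintro ⟨m, hm, hB⟩
    rw [ER_eq Δ r hr] at hm
    obtain ⟨Cs, -, rfl, -⟩ := hm
    obtain ⟨C, -, rfl⟩ := Multiset.mem_map.1 hB
    exact ⟨C, rfl⟩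
  · rintro ⟨C, rfl⟩
    let Cs : Multiset (Finset (Fin Δ)) := C ::ₘ Cᶜ ::ₘ Multiset.replicate (r - 2) Finset.univ
    refine ⟨Cs.map (genE Δ r), ?_, Multiset.mem_map_of_mem _ (Multiset.mem_cons_self _ _)⟩
    rw [ER_eq Δ r hr]
    refine ⟨Cs, by simp [Cs]; omega, rfl, fun i => ?_⟩
    have h0 : Multiset.countP (fun C => i ∉ C)
        (Multiset.replicate (r - 2) (Finset.univ : Finset (Fin Δ))) = 0 := by
      rw [Multiset.countP_eq_zero]
      intro a ha
      rw [Multiset.eq_of_mem_replicate ha]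
      simp
    simp only [Cs, Multiset.countP_cons, h0, Finset.mem_compl]
    by_cases hi : i ∈ C <;> simp [hi]
end

section
/- For each subset C ⊆ 𝔠, the set of all labels of Σ_ℛ that are at least as strong as ⟨ℓ(C)⟩ according to the node constraint 𝒩_ℛ of ℛ(Π) equals {⟨ℓ(C')⟩ : C ⊆ C' ⊆ 𝔠}. -/
open scoped Classical

theorem aux_rep {α β : Type*} {R : α → β → Prop} {a : α} {n : ℕ} {m : Multiset β} :
    Multiset.Rel R (Multiset.replicate n a) m ↔ Multiset.card m = n ∧ ∀ x, x ∈ m → R a x := by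
  induction n generalizing m with
  | zero =>
    simp only [Multiset.replicate_zero, Multiset.rel_zero_left, Multiset.card_eq_zero]
    constructor
    · rintro rfl; simp
    · exact fun h => h.1
  | succ n ih =>
    rw [Multiset.replicate_succ, Multiset.rel_cons_left]
    constructor
    · rintro ⟨b, t, hb, ht, rfl⟩
      obtain ⟨h1, h2⟩ := ih.1 ht
      refine ⟨by simp [h1], fun x hx => ?_⟩
      rcases Multiset.mem_cons.1 hx with rfl | hx
      · exact hb
      · exact h2 x hx
    · rintro ⟨h1, h2⟩
      obtain ⟨b, hb⟩ := Multiset.card_pos_iff_exists_mem.1 (by omega : 0 < Multiset.card m)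
      obtain ⟨t, rfl⟩ := Multiset.exists_cons_of_mem hb
      exact ⟨b, t, h2 b hb, ih.2 ⟨by simpa using h1, fun x hx => h2 x (by simp [hx])⟩, rfl⟩

theorem aux_genE (Δ r : ℕ) (hr : 2 ≤ r) (C : Finset (Fin Δ)) :
    genE Δ r C = {A | A ⊆ C} := by
  obtain ⟨s, rfl⟩ := Nat.exists_eq_add_of_le hr
  ext A
  simp only [genE, Set.mem_ofPred_eq]
  constructor
  · intro h i hi
    by_contra hiC
    have h1 := h (C ::ₘ Cᶜ ::ₘ Multiset.replicate s Finset.univ) (by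
      refine ⟨by simp; omega, fun j => ?_⟩
      by_cases hj : j ∈ C
      · exact ⟨Cᶜ, by simp, by simpa using hj⟩
      · exact ⟨C, by simp, hj⟩) (by simp)
    rw [Multiset.erase_cons_head] at h1
    obtain ⟨D, hD, hiD⟩ := h1.2 i
    simp only [Multiset.mem_cons, Multiset.mem_replicate] at hD
    rcases hD with rfl | rfl | ⟨_, rfl⟩
    · exact hiD hi
    · exact hiD (by simpa using hiC)
    · exact hiD (by simp)
  · intro h m hm hC
    obtain ⟨t, rfl⟩ := Multiset.exists_cons_of_mem hC
    rw [Multiset.erase_cons_head]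
    refine ⟨by simpa using hm.1, fun i => ?_⟩
    obtain ⟨D, hD, hi⟩ := hm.2 i
    rcases Multiset.mem_cons.1 hD with rfl | hD
    · exact ⟨A, by simp, fun h' => hi (h h')⟩
    · exact ⟨D, by simp [hD], hi⟩

theorem aux_choice {L : Type*} (t : Multiset (Set L)) (h : ∀ B ∈ t, B.Nonempty) :
    ∃ c, IsChoice t c := by
  induction t using Multiset.induction_on with
  | empty => exact ⟨0, Multiset.Rel.zero⟩
  | cons B t ih =>
    obtain ⟨c, hc⟩ := ih (fun B hB => h B (by simp [hB]))
    obtain ⟨a, ha⟩ := h B (by simp)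
    exact ⟨a ::ₘ c, Multiset.Rel.cons ha hc⟩

theorem aux_sig1 (Δ r : ℕ) (B : Set (Finset (Fin Δ))) (hB : B ∈ SigR Δ r) :
    ∃ C : Finset (Fin Δ), B = {A | A ⊆ C} := by
  obtain ⟨m, ⟨⟨h1, h2, h3⟩, hmax⟩, hBm⟩ := hB
  obtain ⟨t, rfl⟩ := Multiset.exists_cons_of_mem hBm
  let C : Finset (Fin Δ) := Finset.univ.filter (fun i => ∃ D ∈ B, i ∈ D)
  refine ⟨C, ?_⟩
  have hsub : B ⊆ {A | A ⊆ C} := by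
    intro A hA i hi
    simp only [C, Finset.mem_filter, Finset.mem_univ, true_and]
    exact ⟨A, hA, hi⟩
  have := hmax ({A | A ⊆ C} ::ₘ t) ⟨by simpa using h1, ?_, ?_⟩
    (Multiset.Rel.cons hsub (Multiset.rel_refl_of_refl_on (fun _ _ => subset_rfl)))
  · exact (Multiset.cons_inj_left t).1 this
  · intro X hX
    rcases Multiset.mem_cons.1 hX with rfl | hX
    · exact ⟨∅, by simp⟩
    · exact h2 X (by simp [hX])
  · intro c hc
    obtain ⟨D, c', hD, hc', rfl⟩ := Multiset.rel_cons_left.1 hc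
    obtain ⟨D0, hD0⟩ := h2 B (by simp)
    refine ⟨by simpa using (h3 _ (Multiset.Rel.cons hD0 hc')).1, fun i => ?_⟩
    by_cases hi : i ∈ D
    · have hiC := hD hi
      simp only [C, Finset.mem_filter, Finset.mem_univ, true_and] at hiC
      obtain ⟨D', hD', hiD'⟩ := hiC
      obtain ⟨E, hE, hiE⟩ := (h3 _ (Multiset.Rel.cons hD' hc')).2 i
      rcases Multiset.mem_cons.1 hE with rfl | hE
      · exact absurd hiD' hiE
      · exact ⟨E, by simp [hE], hiE⟩
    · exact ⟨D, by simp, hi⟩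

theorem aux_sig2 (Δ r : ℕ) (hr : 2 ≤ r) (C : Finset (Fin Δ)) :
    {A | A ⊆ C} ∈ SigR Δ r := by
  obtain ⟨s, rfl⟩ := Nat.exists_eq_add_of_le hr
  refine ⟨{A | A ⊆ C} ::ₘ {A | A ⊆ Cᶜ} ::ₘ Multiset.replicate s Set.univ,
    ⟨⟨by simp; omega, ?_, ?_⟩, ?_⟩, by simp⟩
  · intro B hB
    simp only [Multiset.mem_cons, Multiset.mem_replicate] at hB
    rcases hB with rfl | rfl | ⟨_, rfl⟩
    · exact ⟨∅, by simp⟩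
    · exact ⟨∅, by simp⟩
    · exact ⟨∅, by simp⟩
  · intro c hc
    refine ⟨by rw [← Multiset.card_eq_card_of_rel hc]; simp; omega, fun i => ?_⟩
    obtain ⟨X, c', hX, hc', rfl⟩ := Multiset.rel_cons_left.1 hc
    obtain ⟨Y, c'', hY, hc'', rfl⟩ := Multiset.rel_cons_left.1 hc'
    by_cases hi : i ∈ C
    · exact ⟨Y, by simp, fun h => by simpa [hi] using hY h⟩
    · exact ⟨X, by simp, fun h => hi (hX h)⟩
  · intro m' hm' hrel
    obtain ⟨X, c', hX, hc', rfl⟩ := Multiset.rel_cons_left.1 hrel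
    obtain ⟨Y, Z, hY, hc'', rfl⟩ := Multiset.rel_cons_left.1 hc'
    obtain ⟨hZ1, hZ2⟩ := aux_rep.1 hc''
    have hZ : Z = Multiset.replicate s Set.univ :=
      Multiset.eq_replicate.2 ⟨hZ1, fun b hb => Set.univ_subset_iff.1 (hZ2 b hb)⟩
    subst hZ
    have key : ∀ D ∈ X, ∀ E ∈ Y, ∀ i, i ∈ D → i ∉ E := by
      intro D hD E hE i hiD hiE
      have := hm'.2.2 (D ::ₘ E ::ₘ Multiset.replicate s Finset.univ)
        (Multiset.Rel.cons hD (Multiset.Rel.cons hE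
          (aux_rep.2 ⟨Multiset.card_replicate _ _, fun _ _ => Set.mem_univ _⟩)))
      obtain ⟨F, hF, hiF⟩ := this.2 i
      simp only [Multiset.mem_cons, Multiset.mem_replicate] at hF
      rcases hF with rfl | rfl | ⟨_, rfl⟩
      · exact hiF hiD
      · exact hiF hiE
      · exact hiF (by simp)
    have e1 : X = {A | A ⊆ C} := by
      refine Set.Subset.antisymm (fun D hD i hi => ?_) hX
      have := key D hD Cᶜ (hY (by simp)) i hi
      simpa using this
    have e2 : Y = {A | A ⊆ Cᶜ} := by
      refine Set.Subset.antisymm (fun D hD i hi => ?_) hY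
      have := fun h => key C (hX (by simp)) D hD i h hi
      simpa using this
    rw [e1, e2]

theorem aux_main (Δ r : ℕ) (hr : 2 ≤ r) (C C' : Finset (Fin Δ))
    (h : StrEq (NR Δ r) {A | A ⊆ C} {A | A ⊆ C'}) : C ⊆ C' := by
  by_cases hC : C = ∅
  · simp [hC]
  have hpos : 1 ≤ C.card := Finset.card_pos.2 (Finset.nonempty_iff_ne_empty.2 hC)
  have hle : C.card ≤ Δ := by simpa using Finset.card_le_univ C
  have h1 := h ({A | A ⊆ C} ::ₘ (Multiset.replicate (Δ - C.card) {A | A ⊆ C} +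
      Multiset.replicate (C.card - 1) {A | A ⊆ (∅ : Finset (Fin Δ))})) (by
    refine ⟨by simp; omega, ?_, C ::ₘ (Multiset.replicate (Δ - C.card) C +
      Multiset.replicate (C.card - 1) ∅), ?_, C, hC, ?_⟩
    · intro B hB
      simp only [Multiset.mem_cons, Multiset.mem_add, Multiset.mem_replicate] at hB
      rcases hB with rfl | ⟨_, rfl⟩ | ⟨_, rfl⟩ <;> exact aux_sig2 Δ r hr _
    · refine Multiset.Rel.cons (by simp) (Multiset.Rel.add ?_ ?_)
      · exact aux_rep.2 ⟨Multiset.card_replicate _ _, fun x hx => by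
          rw [Multiset.eq_of_mem_replicate hx]; simp⟩
      · exact aux_rep.2 ⟨Multiset.card_replicate _ _, fun x hx => by
          rw [Multiset.eq_of_mem_replicate hx]; simp⟩
    · rw [Multiset.replicate_succ, Multiset.cons_add]) (by simp)
  rw [Multiset.erase_cons_head] at h1
  obtain ⟨_, _, c, hc, D, hD, hcD⟩ := h1
  obtain ⟨d, c1, hd, hc1, rfl⟩ := Multiset.rel_cons_left.1 hc
  obtain ⟨c2, c3, hc2, hc3, rfl⟩ := Multiset.rel_add_left.1 hc1
  obtain ⟨k2, hc2⟩ := aux_rep.1 hc2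
  obtain ⟨k3, hc3⟩ := aux_rep.1 hc3
  have e3 : c3 = Multiset.replicate (C.card - 1) ∅ :=
    Multiset.eq_replicate.2 ⟨k3, fun b hb => Finset.subset_empty.1 (hc3 b hb)⟩
  subst e3
  have hDpos : 1 ≤ D.card := Finset.card_pos.2 (Finset.nonempty_iff_ne_empty.2 hD)
  have hDle : D.card ≤ Δ := by simpa using Finset.card_le_univ D
  have hcount := congrArg (Multiset.count ∅) hcD
  simp only [Multiset.count_cons, Multiset.count_add, Multiset.count_replicate, if_neg hD,
    if_true] at hcount
  have hmemD : D ∈ d ::ₘ (c2 + Multiset.replicate (C.card - 1) ∅) := by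
    rw [hcD]; simp
  have hall : ∀ x ∈ d ::ₘ (c2 + Multiset.replicate (C.card - 1) ∅), x = D ∨ x = ∅ := by
    intro x hx
    rw [hcD] at hx
    simp only [Multiset.mem_add, Multiset.mem_replicate] at hx
    tauto
  have hD2 : D ∈ c2 → D = C ∧ d ≠ ∅ := by
    intro hm
    have hs : D ⊆ C := hc2 D hm
    have hcard := Finset.card_le_card hs
    have hne : d ≠ ∅ := by
      rintro rfl
      simp at hcount
      omega
    exact ⟨Finset.eq_of_subset_of_card_le hs (by omega), hne⟩
  by_cases hm : D ∈ c2
  · obtain ⟨rfl, hne⟩ := hD2 hm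
    rcases hall d (by simp) with rfl | h0
    · exact hd
    · exact absurd h0 hne
  · have hdD : D = d := by
      simp only [Multiset.mem_cons, Multiset.mem_add, Multiset.mem_replicate] at hmemD
      tauto
    subst hdD
    have e2 : c2 = Multiset.replicate (Δ - C.card) ∅ :=
      Multiset.eq_replicate.2 ⟨k2, fun b hb => by
        rcases hall b (by simp [hb]) with rfl | h0
        · exact absurd hb hm
        · exact h0⟩
    subst e2
    have : D = Finset.univ := by
      apply Finset.eq_univ_of_card
      rw [Multiset.count_replicate_self, if_neg (Ne.symm hD)] at hcount
      simp
      omega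
    subst this
    exact (Finset.subset_univ C).trans hd

/-- For each subset `C ⊆ 𝔠`, the set of all labels of Σ_ℛ that are at least as strong as
`⟨ℓ(C)⟩` according to the node constraint 𝒩_ℛ of ℛ(Π) equals `{⟨ℓ(C')⟩ : C ⊆ C' ⊆ 𝔠}`. -/
theorem stmt_4 (Δ r : ℕ) (hΔ : 2 ≤ Δ) (hr : 2 ≤ r) (C : Finset (Fin Δ)) :
    {B | B ∈ SigR Δ r ∧ StrEq (NR Δ r) (genE Δ r C) B} =
      {B | ∃ C' : Finset (Fin Δ), C ⊆ C' ∧ B = genE Δ r C'} := by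
  rw [aux_genE Δ r hr]
  ext B
  simp only [Set.mem_ofPred_eq, aux_genE Δ r hr]
  constructor
  · rintro ⟨hB, hs⟩
    obtain ⟨C', rfl⟩ := aux_sig1 Δ r B hB
    exact ⟨C', aux_main Δ r hr C C' hs, rfl⟩
  · rintro ⟨C', hCC, rfl⟩
    refine ⟨aux_sig2 Δ r hr C', ?_⟩
    intro m hm hmem
    obtain ⟨t, rfl⟩ := Multiset.exists_cons_of_mem hmem
    rw [Multiset.erase_cons_head]
    obtain ⟨h1, h2, c, hc, hN⟩ := hm
    refine ⟨by simpa using h1, ?_, c, ?_, hN⟩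
    · intro X hX
      rcases Multiset.mem_cons.1 hX with rfl | hX
      · exact aux_sig2 Δ r hr C'
      · exact h2 X (by simp [hX])
    · obtain ⟨D, c', hD, hc', rfl⟩ := Multiset.rel_cons_left.1 hc
      exact Multiset.Rel.cons (Finset.Subset.trans hD hCC) hc'
end

section
/- Every finite hypergraph of maximum degree at most Δ admits a (Δ+1)-unique-maximum coloring, i.e., a coloring of its vertices with colors {1, …, Δ+1} such that for every hyperedge e, the maximum color appearing on the vertices of e is attained by exactly one vertex of e. -/
/-- A `c`-unique-maximum coloring of the hypergraph with vertex set `V` and hyperedge set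
`E`: a map `φ : V → {1, …, c}` such that for every hyperedge `e ∈ E`, the maximum value of
`φ` over the vertices of `e` is attained by exactly one vertex of `e`. -/
def IsUniqueMaxColoring {V : Type*} (E : Finset (Finset V)) (c : ℕ) (φ : V → ℕ) : Prop :=
  (∀ v : V, φ v ∈ Finset.Icc 1 c) ∧
  ∀ e ∈ E, (e.filter (fun v => ∀ u ∈ e, φ u ≤ φ v)).card = 1

/-- Every finite hypergraph of maximum degree at most `Δ` (with nonempty hyperedges) admits
a `(Δ+1)`-unique-maximum coloring. -/
theorem stmt_18 {V : Type*} [Fintype V] [DecidableEq V]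
    (E : Finset (Finset V)) (Δ : ℕ)
    (hne : ∀ e ∈ E, e.Nonempty)
    (hdeg : ∀ v : V, (E.filter (fun e => v ∈ e)).card ≤ Δ) :
    ∃ φ : V → ℕ, IsUniqueMaxColoring E (Δ + 1) φ := by
  induction Δ generalizing E with
  | zero =>
    refine ⟨fun _ => 1, fun v => by simp, fun e he => ?_⟩
    obtain ⟨v, hv⟩ := hne e he
    have h := hdeg v
    have h2 : e ∈ E.filter (fun e => v ∈ e) := by simp [he, hv]
    have := Finset.card_pos.2 ⟨e, h2⟩
    omega
  | succ n ih =>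
    classical
    let P : Finset V → Prop := fun S => ∀ e ∈ E, ∀ x ∈ S, ∀ y ∈ S, x ∈ e → y ∈ e → x = y
    obtain ⟨S, hS⟩ := (Set.toFinite {S | P S}).exists_maximal ⟨∅, by simp [P]⟩
    have hSP : P S := hS.prop
    have hmax : ∀ v, v ∉ S → ∃ e ∈ E, v ∈ e ∧ ∃ x ∈ S, x ∈ e := by
      intro v hv
      by_contra hcon
      push Not at hcon
      have hP : P (insert v S) := by
        intro e he x hx y hy hxe hye
        rw [Finset.mem_insert] at hx hy
        rcases hx with rfl | hx <;> rcases hy with rfl | hy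
        · rfl
        · exact absurd hye (hcon e he hxe y hy)
        · exact absurd hxe (hcon e he hye x hx)
        · exact hSP e he x hx y hy hxe hye
      exact hv (hS.le_of_ge hP (Finset.subset_insert v S) (Finset.mem_insert_self v S))
    obtain ⟨φ, hφ1, hφ2⟩ := ih (E.filter (fun e => ∀ x ∈ S, x ∉ e))
      (fun e he => hne e (Finset.mem_filter.1 he).1) (by
        intro v
        by_cases hv : v ∈ S
        · rw [Finset.card_eq_zero.2]
          · omega
          · ext e
            simp only [Finset.mem_filter, Finset.notMem_empty, iff_false]
            rintro ⟨⟨_, h⟩, h'⟩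
            exact h v hv h'
        · obtain ⟨e, he, hve, x, hx, hxe⟩ := hmax v hv
          have : ((E.filter (fun e => ∀ x ∈ S, x ∉ e)).filter (fun e => v ∈ e)).card
              < (E.filter (fun e => v ∈ e)).card := by
            apply Finset.card_lt_card
            refine (Finset.ssubset_iff_of_subset ?_).2 ⟨e, by simp [he, hve], ?_⟩
            · exact Finset.filter_subset_filter _ (Finset.filter_subset _ _)
            · simp only [Finset.mem_filter]
              rintro ⟨⟨_, h⟩, _⟩
              exact h x hx hxe
          have := hdeg v
          omega)
    refine ⟨fun v => if v ∈ S then n + 1 + 1 else φ v, ?_, ?_⟩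
    · intro v
      have := hφ1 v
      simp only [Finset.mem_Icc] at this ⊢
      split_ifs <;> omega
    · intro e he
      by_cases h : ∀ x ∈ S, x ∉ e
      · refine Eq.trans ?_ (hφ2 e (by simp only [Finset.mem_filter]; exact ⟨he, h⟩))
        congr 1
        have h' : ∀ x ∈ e, x ∉ S := fun x hx hs => h x hs hx
        ext v
        simp only [Finset.mem_filter]
        refine and_congr_right fun hv => ?_
        simp only [h' v hv, if_false]
        refine forall₂_congr fun u hu => ?_
        simp only [h' u hu, if_false]
      · push Not at h
        obtain ⟨x, hx, hxe⟩ := h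
        rw [Finset.card_eq_one]
        refine ⟨x, ?_⟩
        ext v
        simp only [Finset.mem_filter, Finset.mem_singleton]
        constructor
        · rintro ⟨hv, hm⟩
          have h1 := hm x hxe
          have h2 := Finset.mem_Icc.1 (hφ1 v)
          by_cases hvS : v ∈ S
          · exact hSP e he v hvS x hx hv hxe
          · simp only [hx, hvS, if_true, if_false] at h1
            omega
        · rintro rfl
          refine ⟨hxe, fun u hu => ?_⟩
          have h2 := Finset.mem_Icc.1 (hφ1 u)
          simp only [hx, if_true]
          split_ifs <;> omega
end

section
/- Let H = (V, E) be a finite hypergraph and let φ : V → {1, …, c} be a c-unique-maximum coloring of H. Define S ⊆ V by recursion on colors: v ∈ S if and only if there is no hyperedge e containing v such that every vertex u ∈ e ∖ {v} satisfies φ(u) < φ(v) and u ∈ S. Then S is a maximal independent set of H: no hyperedge of H is fully contained in S, and for every vertex v ∉ S there exists a hyperedge e containing v with e ∖ {v} ⊆ S. (This is the correctness of the greedy algorithm that processes vertices by increasing color classes and adds a vertex to the independent set whenever possible.) -/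
/-- If `φ` is a `c`-unique-maximum coloring of a finite hypergraph and `S` is the set defined
by recursion on colors (`v ∈ S` iff there is no hyperedge `e ∋ v` all of whose other vertices
have strictly smaller color and belong to `S`), then `S` is a maximal independent set: no
hyperedge is fully contained in `S`, and every vertex outside `S` lies in a hyperedge all of
whose other vertices are in `S`. -/
theorem stmt_19 {V : Type*} [Fintype V] [DecidableEq V]
    (E : Finset (Finset V)) (c : ℕ) (φ : V → ℕ)
    (hcol : IsUniqueMaxColoring E c φ)
    (S : Set V)
    (hS : ∀ v : V, v ∈ S ↔ ¬ ∃ e ∈ E, v ∈ e ∧ ∀ u ∈ e, u ≠ v → φ u < φ v ∧ u ∈ S) :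
    (∀ e ∈ E, ¬ (↑e ⊆ S)) ∧
    (∀ v : V, v ∉ S → ∃ e ∈ E, v ∈ e ∧ ∀ u ∈ e, u ≠ v → u ∈ S) := by
  refine ⟨fun e he hsub => ?_, fun v hv => ?_⟩
  · obtain ⟨v, hv⟩ := Finset.card_eq_one.mp (hcol.2 e he)
    have key : ∀ w, (w ∈ e ∧ ∀ u ∈ e, φ u ≤ φ w) ↔ w = v := fun w => by
      rw [← Finset.mem_singleton, ← hv]; exact (@Finset.mem_filter V (fun v => ∀ u ∈ e, φ u ≤ φ v) (fun _ => Finset.decidableDforallFinset) e w).symm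
    obtain ⟨hve, hmax⟩ := (key v).mpr rfl
    refine (hS v).mp (hsub hve) ⟨e, he, hve, fun u hu huv => ⟨?_, hsub hu⟩⟩
    by_contra hlt
    exact huv ((key u).mp ⟨hu, fun w hw => (hmax w hw).trans (not_lt.mp hlt)⟩)
  · rw [hS v, not_not] at hv
    obtain ⟨e, he, hve, h⟩ := hv
    exact ⟨e, he, hve, fun u hu huv => (h u hu huv).2⟩
end
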